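/- Let (X, r) be a non-degenerate involutive set-theoretic solution of the Yang–Baxter equation with |X| = m ≥ 2, and let λ ∈ P(n, m). Then the number of orbits of X^n contained in B(λ) is exactly Perm(λ). -/

import Mathlib

/-! Set-theoretic solutions of the Yang–Baxter equation.
For `r : X × X → X × X` we write `r (i, j) = (σ i j, τ j i)`, i.e. `σ_i(j) = σ i j` and
`τ_j(i) = τ j i`. -/

variable {X : Type*}

/-- The map `r : X × X → X × X` determined by families `σ`, `τ` via
`r (i, j) = (σ_i(j), τ_j(i))`. -/
def rmapF (σ τ : X → X → X) : X × X → X × X := fun p => (σ p.1 p.2, τ p.2 p.1)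

/-- `r × id` on `X × X × X`. -/
def ridF (r : X × X → X × X) : X × X × X → X × X × X :=
  fun p => ((r (p.1, p.2.1)).1, (r (p.1, p.2.1)).2, p.2.2)

/-- `id × r` on `X × X × X`. -/
def idrF (r : X × X → X × X) : X × X × X → X × X × X := fun p => (p.1, r p.2)

/-- The braid (Yang–Baxter) equation `(r × id) ∘ (id × r) ∘ (r × id) = (id × r) ∘ (r × id) ∘ (id × r)`. -/
def BraidEq (r : X × X → X × X) : Prop :=
  ridF r ∘ idrF r ∘ ridF r = idrF r ∘ ridF r ∘ idrF r

/-- A non-degenerate involutive set-theoretic solution of the Yang–Baxter equation on `X`: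
the maps `σ_i` and `τ_i` are bijective (packaged as equivalences), the induced map
`r (i, j) = (σ_i(j), τ_j(i))` satisfies the braid equation, and `r ∘ r = id`
(which in particular makes `r` bijective). -/
structure NDIS (X : Type*) where
  σ : X → X ≃ X
  τ : X → X ≃ X
  braid : BraidEq (rmapF (fun i => ⇑(σ i)) (fun i => ⇑(τ i)))
  invol : ∀ p : X × X,
    rmapF (fun i => ⇑(σ i)) (fun i => ⇑(τ i))
      (rmapF (fun i => ⇑(σ i)) (fun i => ⇑(τ i)) p) = p

namespace NDIS

/-- The map `r` of the solution. -/
def r (S : NDIS X) : X × X → X × X := rmapF (fun i => ⇑(S.σ i)) (fun i => ⇑(S.τ i))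

/-- The diagonal `D : X → X`, `D(i) = τ_i⁻¹(i)`. -/
def D (S : NDIS X) : X → X := fun i => (S.τ i).symm i

end NDIS
namespace NDIS

/-- One elementary move on words: apply `r` to two adjacent letters. -/
def Step (S : NDIS X) (x y : List X) : Prop :=
  ∃ (u v : List X) (i j : X), x = u ++ i :: j :: v ∧ y = u ++ S.σ i j :: S.τ j i :: v

/-- The orbit `O(x)` of a word `x` under the equivalence relation generated by the
adjacent `r`-moves (equivalently, the orbit of the induced `S_n`-action on `X^n`). -/
def Orb (S : NDIS X) (x : List X) : Set (List X) := {y | Relation.EqvGen S.Step x y}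

/-- `Ψ_k(a) = (D^{k−1}(a), …, D(a), a)`. -/
def Psi (S : NDIS X) (k : ℕ) (a : X) : List X :=
  (List.range k).map fun t => S.D^[k - 1 - t] a

/-- The inverse of the diagonal `D`. -/
noncomputable def Dinv (S : NDIS X) [Nonempty X] : X → X := Function.invFun S.D

/-- `Ψ_{−k}(a) = (a, D^{−1}(a), …, D^{−(k−1)}(a))`. -/
noncomputable def PsiNeg (S : NDIS X) [Nonempty X] (k : ℕ) (a : X) : List X :=
  (List.range k).map fun t => S.Dinv^[t] a

/-- `σ_x = σ_{a_1} ∘ σ_{a_2} ∘ ⋯ ∘ σ_{a_k}` for a word `x = (a_1, …, a_k)`. -/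
def sigmaWord (S : NDIS X) (x : List X) (z : X) : X := x.foldr (fun a w => S.σ a w) z

/-- `τ_x = τ_{a_k} ∘ ⋯ ∘ τ_{a_2} ∘ τ_{a_1}` for a word `x = (a_1, …, a_k)`. -/
def tauWord (S : NDIS X) (x : List X) (z : X) : X := x.foldl (fun w a => S.τ a w) z

/-- The concatenation `Ψ_{L 0}(a 0) Ψ_{L 1}(a 1) ⋯ Ψ_{L (k-1)}(a (k-1))`. -/
def word (S : NDIS X) {k : ℕ} (L : Fin k → ℕ) (a : Fin k → X) : List X :=
  (List.ofFn fun t => S.Psi (L t) (a t)).flatten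

/-- The concatenation `Ψ_{L (i+1)}(a (i+1)) ⋯ Ψ_{L (j-1)}(a (j-1))` of the blocks strictly
between positions `i` and `j` (the empty word when `j = i + 1`). -/
def midword (S : NDIS X) {k : ℕ} (L : Fin k → ℕ) (a : Fin k → X) (i j : Fin k) : List X :=
  (((List.ofFn fun t => S.Psi (L t) (a t)).drop ((i : ℕ) + 1)).take ((j : ℕ) - (i : ℕ) - 1)).flatten

/-- The family `a` yields a `λ`-element: `a_j ≠ D^{−λ_j}(τ_w(a_i))` for all `i < j`, with
`w = Ψ_{λ_{i+1}}(a_{i+1}) ⋯ Ψ_{λ_{j−1}}(a_{j−1})`. -/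
def IsLambdaFamily (S : NDIS X) [Nonempty X] {k : ℕ} (L : Fin k → ℕ) (a : Fin k → X) : Prop :=
  ∀ i j : Fin k, i < j →
    a j ≠ S.Dinv^[L j] (S.tauWord (S.midword L a i j) (a i))

/-- `x` is a `λ`-element for the partition with positive parts `L 0 ≥ L 1 ≥ ⋯ ≥ L (k-1) > 0`. -/
def IsLambdaWord (S : NDIS X) [Nonempty X] {k : ℕ} (L : Fin k → ℕ) (x : List X) : Prop :=
  ∃ a : Fin k → X, x = S.word L a ∧ S.IsLambdaFamily L a

/-- The bijection `b` of `X^n` applying `r` to the entries in (0-based) positions `j` and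
`j + 1` and fixing all other entries. -/
def bmap (S : NDIS X) {n : ℕ} (j : ℕ) (hj : j + 1 < n) (x : Fin n → X) : Fin n → X :=
  fun t =>
    if (t : ℕ) = j then S.σ (x ⟨j, by omega⟩) (x ⟨j + 1, hj⟩)
    else if (t : ℕ) = j + 1 then S.τ (x ⟨j + 1, hj⟩) (x ⟨j, by omega⟩)
    else x t

/-- One elementary move on `X^n` (as functions `Fin n → X`). -/
def StepF (S : NDIS X) {n : ℕ} (x y : Fin n → X) : Prop :=
  ∃ (j : ℕ) (hj : j + 1 < n), y = S.bmap j hj x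

end NDIS

/-- The offset `λ_1 + ⋯ + λ_i` of the `i`-th block (0-based). -/
def blockOffset {k : ℕ} (L : Fin k → ℕ) (i : Fin k) : ℕ :=
  ∑ t ∈ Finset.univ.filter (fun t => t < i), L t

/-- A `(λ_1, …, λ_k)`-shuffle: a permutation strictly increasing on each consecutive block. -/
def IsShuffle {k n : ℕ} (L : Fin k → ℕ) (θ : Equiv.Perm (Fin n)) : Prop :=
  ∀ (i : Fin k) (p q : Fin n), blockOffset L i ≤ (p : ℕ) → p < q →
    (q : ℕ) < blockOffset L i + L i → θ p < θ q

namespace NDIS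

section aux
variable (S : NDIS X)

lemma aux_inv1 (i j : X) : S.σ (S.σ i j) (S.τ j i) = i :=
  congrArg Prod.fst (S.invol (i, j))

lemma aux_inv2 (i j : X) : S.τ (S.τ j i) (S.σ i j) = j :=
  congrArg Prod.snd (S.invol (i, j))

/-- The third component of the braid equation. -/
lemma aux_braid (i j z : X) :
    S.τ (S.τ j i) (S.τ (S.σ i j) z) = S.τ j (S.τ i z) := by
  have h := congrFun S.braid (z, i, j)
  have h2 := congrArg (fun p => p.2.2) h
  simp only [ridF, idrF, rmapF, Function.comp] at h2
  exact h2.symm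

@[simp] lemma tauWord_nil (z : X) : S.tauWord [] z = z := rfl
@[simp] lemma tauWord_cons (a : X) (w : List X) (z : X) :
    S.tauWord (a :: w) z = S.tauWord w (S.τ a z) := rfl
lemma tauWord_append (u w : List X) (z : X) :
    S.tauWord (u ++ w) z = S.tauWord w (S.tauWord u z) := by
  simp [tauWord, List.foldl_append]

lemma tauWord_inj (w : List X) : Function.Injective (S.tauWord w) := by
  induction w with
  | nil => intro a b h; simpa using h
  | cons a w ih => intro x y h; exact (S.τ a).injective (ih h)

lemma tauWord_surj (w : List X) : Function.Surjective (S.tauWord w) := by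
  induction w with
  | nil => intro a; exact ⟨a, rfl⟩
  | cons a w ih =>
    intro x
    obtain ⟨y, rfl⟩ := ih x
    exact ⟨(S.τ a).symm y, by simp⟩

/-- The map to multisets (as lists). -/
def J (S : NDIS X) : List X → List X
  | [] => []
  | a :: w => S.tauWord w a :: J S w

lemma J_append (u w : List X) : S.J (u ++ w) = (S.J u).map (S.tauWord w) ++ S.J w := by
  induction u with
  | nil => rfl
  | cons a u ih => simp [J, ih, tauWord_append]

lemma J_surj (l : List X) : ∃ x, S.J x = l := by
  induction l with
  | nil => exact ⟨[], rfl⟩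
  | cons a l ih =>
    obtain ⟨x, rfl⟩ := ih
    obtain ⟨b, rfl⟩ := S.tauWord_surj x a
    exact ⟨b :: x, rfl⟩

lemma J_inj : ∀ x y : List X, S.J x = S.J y → x = y
  | [], [], _ => rfl
  | [], _ :: _, h => by simp [J] at h
  | _ :: _, [], h => by simp [J] at h
  | a :: x, b :: y, h => by
    simp only [J, List.cons.injEq] at h
    obtain rfl := J_inj x y h.2
    rw [S.tauWord_inj x h.1]

lemma step_tau {x y : List X} (h : S.Step x y) : S.tauWord x = S.tauWord y := by
  obtain ⟨u, v, i, j, rfl, rfl⟩ := h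
  funext z
  simp [tauWord_append, aux_braid]

lemma step_J {x y : List X} (h : S.Step x y) : (S.J x).Perm (S.J y) := by
  obtain ⟨u, v, i, j, rfl, rfl⟩ := h
  have ht : S.tauWord (i :: j :: v) = S.tauWord (S.σ i j :: S.τ j i :: v) :=
    S.step_tau ⟨[], v, i, j, rfl, rfl⟩
  rw [J_append, J_append, ht]
  refine List.Perm.append_left _ ?_
  simp only [J, tauWord_cons, aux_inv2]
  exact List.Perm.swap _ _ _

lemma eqv_tau {x y : List X} (h : Relation.EqvGen S.Step x y) : S.tauWord x = S.tauWord y := by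
  induction h with
  | rel _ _ h => exact S.step_tau h
  | refl => rfl
  | symm _ _ _ ih => exact ih.symm
  | trans _ _ _ _ _ h1 h2 => exact h1.trans h2

lemma eqv_J {x y : List X} (h : Relation.EqvGen S.Step x y) : (S.J x).Perm (S.J y) := by
  induction h with
  | rel _ _ h => exact S.step_J h
  | refl => exact List.Perm.refl _
  | symm _ _ _ ih => exact ih.symm
  | trans _ _ _ _ _ h1 h2 => exact h1.trans h2

lemma eqv_cons (a : X) {x y : List X} (h : Relation.EqvGen S.Step x y) :
    Relation.EqvGen S.Step (a :: x) (a :: y) := by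
  induction h with
  | rel _ _ h =>
    obtain ⟨u, v, i, j, rfl, rfl⟩ := h
    exact .rel _ _ ⟨a :: u, v, i, j, rfl, rfl⟩
  | refl => exact .refl _
  | symm _ _ _ ih => exact .symm _ _ ih
  | trans _ _ _ _ _ h1 h2 => exact .trans _ _ _ h1 h2

lemma eqv_of_perm {l l' : List X} (h : l.Perm l') :
    ∀ x y, S.J x = l → S.J y = l' → Relation.EqvGen S.Step x y := by
  induction h with
  | nil =>
    intro x y hx hy
    rw [S.J_inj x y (hx.trans hy.symm)]
    exact .refl _
  | @cons c l l' h ih =>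
    intro x y hx hy
    match x, y, hx, hy with
    | a :: x, b :: y, hx, hy =>
      simp only [J, List.cons.injEq] at hx hy
      have e := ih x y hx.2 hy.2
      have : a = b := by
        apply S.tauWord_inj x
        rw [hx.1, S.eqv_tau e, hy.1]
      subst this
      exact S.eqv_cons a e
  | swap p q l =>
    intro x y hx hy
    match x, y, hx, hy with
    | a :: b :: v, c :: d :: v', hx, hy =>
      simp only [J, List.cons.injEq] at hx hy
      obtain ⟨h1, h2, h3⟩ := hx
      obtain ⟨h4, h5, h6⟩ := hy
      obtain rfl := S.J_inj v v' (h3.trans h6.symm)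
      have hd : d = S.τ b a := S.tauWord_inj v (h5.trans h1.symm)
      have hc : S.τ d c = b := S.tauWord_inj v (h4.trans h2.symm)
      subst hd
      have : c = S.σ a b := (S.τ (S.τ b a)).injective (by rw [hc, aux_inv2])
      subst this
      exact .rel _ _ ⟨[], v, a, b, rfl, rfl⟩
    | [a], _, hx, _ => simp [J] at hx
    | _, [a], _, hy => simp [J] at hy
  | @trans l1 l2 l3 _ _ h1 h2 =>
    intro x y hx hy
    obtain ⟨z, hz⟩ := S.J_surj l2
    exact .trans _ _ _ (h1 x z hx hz) (h2 z y hz hy)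

lemma mem_Orb (x y : List X) : y ∈ S.Orb x ↔ (S.J x).Perm (S.J y) :=
  ⟨fun h => S.eqv_J h, fun h => S.eqv_of_perm h x y rfl rfl⟩

lemma tau_D (a : X) : S.τ a (S.D a) = a := by simp [D]

lemma D_inj : Function.Injective S.D := by
  have key : ∀ i, S.σ (S.D i) i = S.D i := by
    intro i
    have h := S.aux_inv2 (S.D i) i
    rw [tau_D] at h
    apply (S.τ i).injective
    rw [h, tau_D]
  intro i j h
  have hi := key i
  rw [h, ← key j] at hi
  rw [key j] at hi
  exact (S.σ (S.D j)).injective (hi.trans (key j).symm)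

lemma Psi_succ (k : ℕ) (a : X) : S.Psi (k + 1) a = S.D^[k] a :: S.Psi k a := by
  simp only [Psi, List.range_succ_eq_map, List.map_cons, List.map_map]
  congr 1
  apply List.map_congr_left
  intro t ht
  have e : k + 1 - 1 - t.succ = k - 1 - t := by omega
  simp only [Function.comp, e]

lemma tau_Psi (k : ℕ) (a : X) : S.tauWord (S.Psi k a) (S.D^[k] a) = a := by
  induction k with
  | zero => rfl
  | succ k ih =>
    rw [Psi_succ, tauWord_cons, Function.iterate_succ_apply', tau_D, ih]

lemma J_Psi (k : ℕ) (a : X) : S.J (S.Psi k a) = List.replicate k a := by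
  induction k with
  | zero => rfl
  | succ k ih => rw [Psi_succ, J, tau_Psi, ih, List.replicate_succ]

/-- The values of the blocks. -/
def cfun (S : NDIS X) {k : ℕ} (L : Fin k → ℕ) (a : Fin k → X) (i : Fin k) : X :=
  S.tauWord ((List.ofFn fun t => S.Psi (L t) (a t)).drop ((i : ℕ) + 1)).flatten (a i)

lemma cfun_succ {k : ℕ} (L : Fin (k+1) → ℕ) (a : Fin (k+1) → X) (i : Fin k) :
    S.cfun L a i.succ = S.cfun (fun t => L t.succ) (fun t => a t.succ) i := by
  simp [cfun, List.ofFn_succ]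

lemma cfun_zero {k : ℕ} (L : Fin (k+1) → ℕ) (a : Fin (k+1) → X) :
    S.cfun L a 0 = S.tauWord (S.word (fun t => L t.succ) (fun t => a t.succ)) (a 0) := by
  simp [cfun, List.ofFn_succ, word]

lemma word_succ {k : ℕ} (L : Fin (k+1) → ℕ) (a : Fin (k+1) → X) :
    S.word L a = S.Psi (L 0) (a 0) ++ S.word (fun t => L t.succ) (fun t => a t.succ) := by
  simp [word, List.ofFn_succ]

lemma cfun_surj : ∀ {k : ℕ} (L : Fin k → ℕ) (c : Fin k → X), ∃ a, S.cfun L a = c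
  | 0, _, c => ⟨c, by funext i; exact i.elim0⟩
  | k + 1, L, c => by
    obtain ⟨a, ha⟩ := cfun_surj (fun t => L t.succ) (fun t => c t.succ)
    obtain ⟨b, hb⟩ := S.tauWord_surj (S.word (fun t => L t.succ) a) (c 0)
    refine ⟨Fin.cons b a, ?_⟩
    funext i
    refine Fin.cases ?_ (fun i => ?_) i
    · rw [cfun_zero]; simpa using hb
    · rw [cfun_succ]; simpa using congrFun ha i

lemma count_J_word [DecidableEq X] : ∀ {k : ℕ} (L : Fin k → ℕ) (a : Fin k → X) (x : X),
    (S.J (S.word L a)).count x = ∑ i, if S.cfun L a i = x then L i else 0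
  | 0, _, _, _ => by simp [word, J]
  | k + 1, L, a, x => by
    rw [word_succ, J_append, List.count_append, count_J_word, Fin.sum_univ_succ, J_Psi,
      List.map_replicate, ← cfun_zero, List.count_replicate]
    simp only [cfun_succ, beq_iff_eq]

lemma Dinv_ne_iff [Finite X] [Nonempty X] (k : ℕ) (a b : X) :
    a ≠ S.Dinv^[k] b ↔ S.D^[k] a ≠ b := by
  have h1 : Function.LeftInverse S.Dinv S.D := Function.leftInverse_invFun S.D_inj
  have h2 : Function.RightInverse S.Dinv S.D :=
    Function.rightInverse_invFun (Finite.surjective_of_injective S.D_inj)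
  refine not_congr ⟨?_, ?_⟩
  · rintro rfl; exact h2.iterate k b
  · rintro rfl; exact (h1.iterate k a).symm

lemma lambda_iff [Finite X] [Nonempty X] {k : ℕ} (L : Fin k → ℕ) (a : Fin k → X) :
    S.IsLambdaFamily L a ↔ Function.Injective (S.cfun L a) := by
  have key : ∀ i j : Fin k, i < j →
      ((a j ≠ S.Dinv^[L j] (S.tauWord (S.midword L a i j) (a i))) ↔
        S.cfun L a j ≠ S.cfun L a i) := by
    intro i j hij
    rw [Dinv_ne_iff]
    have hsplit : ((List.ofFn fun t => S.Psi (L t) (a t)).drop ((i : ℕ) + 1)).flatten =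
        S.midword L a i j ++ (S.Psi (L j) (a j) ++
          ((List.ofFn fun t => S.Psi (L t) (a t)).drop ((j : ℕ) + 1)).flatten) := by
      have hij' : (i : ℕ) < j := hij
      have e1 : ((i : ℕ) + 1) + ((j : ℕ) - i - 1) = j := by omega
      have e2 : (List.ofFn fun t => S.Psi (L t) (a t)).drop (j : ℕ) = S.Psi (L j) (a j) ::
          (List.ofFn fun t => S.Psi (L t) (a t)).drop ((j : ℕ) + 1) := by
        rw [List.drop_eq_getElem_cons (by simp)]
        simp
      have e3 := congrArg List.flatten (List.take_append_drop ((j : ℕ) - i - 1)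
        ((List.ofFn fun t => S.Psi (L t) (a t)).drop ((i : ℕ) + 1)))
      rw [List.flatten_append, List.drop_drop, e1, e2, List.flatten_cons] at e3
      exact e3.symm
    have h1 : S.cfun L a i = S.tauWord ((List.ofFn fun t => S.Psi (L t) (a t)).drop
        ((j : ℕ) + 1)).flatten (S.tauWord (S.Psi (L j) (a j))
          (S.tauWord (S.midword L a i j) (a i))) := by
      rw [cfun, hsplit, tauWord_append, tauWord_append]
    have h2 : S.cfun L a j = S.tauWord ((List.ofFn fun t => S.Psi (L t) (a t)).drop
        ((j : ℕ) + 1)).flatten (S.tauWord (S.Psi (L j) (a j)) (S.D^[L j] (a j))) := by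
      rw [cfun, tau_Psi]
    rw [h1, h2, (S.tauWord_inj _).ne_iff, (S.tauWord_inj _).ne_iff]
  constructor
  · intro h i j hc
    by_contra hne
    rcases lt_or_gt_of_ne hne with hl | hl
    · exact (key i j hl).1 (h i j hl) hc.symm
    · exact (key j i hl).1 (h j i hl) hc
  · intro h i j hij
    exact (key i j hij).2 (fun e => hij.ne (h e).symm)

end aux

end NDIS

/-- The multiplicity function attached to `c`. -/
noncomputable def multF {X : Type*} {k : ℕ} (L : Fin k → ℕ) (c : Fin k → X) (x : X) : ℕ :=
  by classical exact ∑ i, if c i = x then L i else 0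

lemma multF_apply {X : Type*} {k : ℕ} (L : Fin k → ℕ) (c : Fin k → X)
    (hc : Function.Injective c) (i : Fin k) : multF L c (c i) = L i := by
  classical
  simp [multF, hc.eq_iff]

lemma multF_notin {X : Type*} {k : ℕ} (L : Fin k → ℕ) (c : Fin k → X) (x : X)
    (hx : x ∉ Set.range c) : multF L c x = 0 := by
  classical
  refine Finset.sum_eq_zero fun i _ => if_neg fun h => hx ⟨i, h⟩

lemma exists_perm_ext {X : Type*} [Fintype X] {k : ℕ} (c e : Fin k → X)
    (hc : Function.Injective c) (he : Function.Injective e) :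
    ∃ g : Equiv.Perm X, ∀ i, g (e i) = c i := by
  classical
  let f : {x // x ∈ Set.range e} ≃ {x // x ∈ Set.range c} :=
    (Equiv.ofInjective e he).symm.trans (Equiv.ofInjective c hc)
  refine ⟨f.extendSubtype, fun i => ?_⟩
  rw [Equiv.extendSubtype_apply_of_mem f (e i) ⟨i, rfl⟩]
  have : (Equiv.ofInjective e he).symm ⟨e i, ⟨i, rfl⟩⟩ = i :=
    Equiv.ofInjective_symm_apply he i
  simp [f, this]

lemma card_multF {X : Type*} [Fintype X] {n k : ℕ} (L : Fin k → ℕ) (hpos : ∀ t, 0 < L t)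
    (hsum : ∑ t, L t = n) (hk : k ≤ Fintype.card X) :
    {f : X → ℕ | ∃ c : Fin k → X, Function.Injective c ∧ f = multF L c}.ncard =
      Nat.factorial (Fintype.card X) /
        (Nat.factorial (Fintype.card X - k) *
          ∏ i ∈ Finset.Icc 1 n,
            Nat.factorial ((Finset.univ.filter fun t => L t = i).card)) := by
  classical
  obtain ⟨e⟩ : Nonempty (Fin k ↪ X) :=
    Function.Embedding.nonempty_of_card_le (by simpa using hk)
  have he := e.injective
  set f0 : X → ℕ := multF L e with hf0
  have hset : {f : X → ℕ | ∃ c : Fin k → X, Function.Injective c ∧ f = multF L c} =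
      MulAction.orbit (DomMulAct (Equiv.Perm X)) f0 := by
    have hcomp : ∀ (g : Equiv.Perm X) (c : Fin k → X),
        multF L (fun i => g (c i)) = fun x => multF L c (g.symm x) := by
      intro g c
      funext x
      simp only [multF]
      refine Finset.sum_congr rfl fun i _ => ?_
      simp [Equiv.eq_symm_apply]
    ext f
    constructor
    · rintro ⟨c, hc, rfl⟩
      obtain ⟨g, hg⟩ := exists_perm_ext c e hc he
      refine ⟨DomMulAct.mk g.symm, ?_⟩
      have : c = fun i => g (e i) := by funext i; exact (hg i).symm
      rw [this, hcomp]
      rfl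
    · rintro ⟨g, rfl⟩
      refine ⟨fun i => (DomMulAct.mk.symm g).symm (e i),
        (DomMulAct.mk.symm g).symm.injective.comp he, ?_⟩
      rw [hcomp]
      rfl
  rw [hset]
  have horb : Nat.card (MulAction.orbit (DomMulAct (Equiv.Perm X)) f0) *
      Nat.card (MulAction.stabilizer (DomMulAct (Equiv.Perm X)) f0) =
      Nat.factorial (Fintype.card X) := by
    rw [← Nat.card_prod, Nat.card_congr
      (MulAction.orbitProdStabilizerEquivGroup (DomMulAct (Equiv.Perm X)) f0),
      Nat.card_congr (DomMulAct.mk (M := Equiv.Perm X)).symm, Nat.card_eq_fintype_card,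
      Fintype.card_perm]
  have hstab : Nat.card (MulAction.stabilizer (DomMulAct (Equiv.Perm X)) f0) =
      Nat.factorial (Fintype.card X - k) *
          ∏ i ∈ Finset.Icc 1 n,
            Nat.factorial ((Finset.univ.filter fun t => L t = i).card) := by
    have h1 : Nat.card (MulAction.stabilizer (DomMulAct (Equiv.Perm X)) f0) =
        Nat.card {g : Equiv.Perm X // f0 ∘ g = f0} := by
      symm
      exact Nat.card_congr (Equiv.subtypeEquiv DomMulAct.mk fun _ => Iff.rfl)
    have hle : ∀ i, L i ≤ n := fun i => by
      rw [← hsum]; exact Finset.single_le_sum (fun _ _ => Nat.zero_le _) (Finset.mem_univ i)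
    have hval : ∀ x, (∃ i, e i = x ∧ f0 x = L i) ∨ (x ∉ Set.range e ∧ f0 x = 0) := by
      intro x
      by_cases hx : x ∈ Set.range e
      · obtain ⟨i, rfl⟩ := hx
        exact Or.inl ⟨i, rfl, multF_apply L e he i⟩
      · exact Or.inr ⟨hx, multF_notin L e x hx⟩
    have hsub : Finset.univ.image f0 ⊆ insert 0 (Finset.Icc 1 n) := by
      intro v hv
      obtain ⟨x, -, rfl⟩ := Finset.mem_image.1 hv
      rcases hval x with ⟨i, -, hi⟩ | ⟨-, hi⟩
      · rw [hi]
        exact Finset.mem_insert_of_mem (Finset.mem_Icc.2 ⟨hpos i, hle i⟩)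
      · rw [hi]; exact Finset.mem_insert_self _ _
    rw [h1, Nat.card_eq_fintype_card, DomMulAct.stabilizer_card' (f := f0),
      Finset.prod_subset hsub, Finset.prod_insert (by simp)]
    · congr 1
      · congr 1
        have : (Finset.univ.filter fun x => f0 x = 0) = (Finset.univ.image e)ᶜ := by
          ext x
          simp only [Finset.mem_filter, Finset.mem_univ, true_and, Finset.mem_compl,
            Finset.mem_image]
          rcases hval x with ⟨i, hx, hi⟩ | ⟨hx, hi⟩
          · have := hpos i
            constructor
            · intro h; omega
            · intro h; exact absurd ⟨i, hx⟩ h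
          · exact ⟨fun _ => hx, fun _ => hi⟩
        rw [Fintype.card_subtype, this, Finset.card_compl, Finset.card_image_of_injective _ he,
          Finset.card_univ, Fintype.card_fin]
      · refine Finset.prod_congr rfl fun v hv => ?_
        congr 1
        have hv1 := (Finset.mem_Icc.1 hv).1
        have : (Finset.univ.filter fun x => f0 x = v) =
            (Finset.univ.filter fun t => L t = v).image e := by
          ext x
          simp only [Finset.mem_filter, Finset.mem_univ, true_and, Finset.mem_image]
          constructor
          · intro h
            rcases hval x with ⟨i, hx, hi⟩ | ⟨hx, hi⟩
            · exact ⟨i, by omega, hx⟩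
            · omega
          · rintro ⟨i, hi, rfl⟩
            rw [← hi]; exact multF_apply L e he i
        rw [Fintype.card_subtype, this, Finset.card_image_of_injective _ he]
    · intro v _ hv
      have : IsEmpty {a // f0 a = v} :=
        ⟨fun a => hv (Finset.mem_image.2 ⟨a.1, Finset.mem_univ _, a.2⟩)⟩
      simp
  rw [← Nat.card_coe_set_eq, ← hstab, ← horb, Nat.mul_div_cancel]
  have : 0 < Nat.factorial (Fintype.card X) := Nat.factorial_pos _
  rw [← horb] at this
  exact Nat.pos_of_mul_pos_left this

/-- Let `(X, r)` be a non-degenerate involutive solution with `|X| = m ≥ 2`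
and `λ ∈ P(n, m)` with positive parts `L` (so `λ` has `m − k` zero parts). Then the
number of orbits of `X^n` contained in `B(λ)` (the union of the orbits of all
`λ`-elements) equals `Perm(λ) = m! / (k_n! ⋯ k_1! k_0!)`, where `k_i` is the number of
parts of `λ` equal to `i` (in particular `k_0 = m − k`). -/
theorem card_orbits_in_B_lambda {X : Type*} [Fintype X] [Nonempty X]
    (S : NDIS X) (hm : 2 ≤ Fintype.card X)
    {n k : ℕ} (L : Fin k → ℕ) (hpos : ∀ t, 0 < L t) (hmono : Antitone L)
    (hsum : ∑ t, L t = n) (hk : k ≤ Fintype.card X) :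
    {C : Set (List X) | ∃ x : List X, S.IsLambdaWord L x ∧ C = S.Orb x}.ncard =
      Nat.factorial (Fintype.card X) /
        (Nat.factorial (Fintype.card X - k) *
          ∏ i ∈ Finset.Icc 1 n,
            Nat.factorial ((Finset.univ.filter fun t => L t = i).card)) := by
  classical
  rw [← card_multF L hpos hsum hk]
  let G : (X → ℕ) → Set (List X) := fun f => {y | ∀ x, (S.J y).count x = f x}
  have hG : ∀ a : Fin k → X, G (multF L (S.cfun L a)) = S.Orb (S.word L a) := by
    intro a
    ext y
    rw [S.mem_Orb, List.perm_iff_count]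
    refine forall_congr' fun x => ?_
    rw [S.count_J_word]
    simp only [multF]
    constructor
    · intro h; rw [h]
    · intro h; rw [← h]
  have himg : {C : Set (List X) | ∃ x : List X, S.IsLambdaWord L x ∧ C = S.Orb x} =
      Set.image G {f : X → ℕ | ∃ c : Fin k → X, Function.Injective c ∧ f = multF L c} := by
    ext C
    constructor
    · rintro ⟨x, ⟨a, rfl, ha⟩, rfl⟩
      exact ⟨_, ⟨_, (S.lambda_iff L a).1 ha, rfl⟩, hG a⟩
    · rintro ⟨f, ⟨c, hc, rfl⟩, rfl⟩
      obtain ⟨a, rfl⟩ := S.cfun_surj L c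
      exact ⟨_, ⟨a, rfl, (S.lambda_iff L a).2 hc⟩, hG a⟩
  rw [himg]
  refine Set.InjOn.ncard_image ?_
  rintro f ⟨c, hc, rfl⟩ f' _ h
  obtain ⟨a, rfl⟩ := S.cfun_surj L c
  have h1 : S.word L a ∈ G (multF L (S.cfun L a)) := by
    rw [hG]; exact Relation.EqvGen.refl _
  have h2 := h1
  rw [h] at h2
  funext x
  exact (h1 x).symm.trans (h2 x)
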